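/- arXiv:2201.10892 — 2 statements merged into one kernel-verified Lean document; each statement's English description precedes it below -/
import Mathlib

section
/- Let n ≥ 5 and let W be a self-annihilating subspace of the space Λ²(ℝⁿ) of alternating 2-forms (2-vectors) over ℝⁿ. Then dim W ≤ n − 1. -/
namespace EKR

variable {n : ℕ}

local notation "V" => (Fin n → ℝ)
local notation "A" => (ExteriorAlgebra ℝ (Fin n → ℝ))

/-- Contraction by a covector. -/
noncomputable def c (d : Module.Dual ℝ V) : A →ₗ[ℝ] A :=
  CliffordAlgebra.contractLeft (Q := (0 : QuadraticForm ℝ V)) d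

/-- The inclusion of vectors. -/
noncomputable def i : V →ₗ[ℝ] A := ExteriorAlgebra.ι ℝ

lemma i_inj : Function.Injective (i (n := n)) :=
  ExteriorAlgebra.ι_leftInverse.injective

lemma c_i (d : Module.Dual ℝ V) (v : V) : c d (i v) = algebraMap ℝ A (d v) :=
  CliffordAlgebra.contractLeft_ι (Q := (0 : QuadraticForm ℝ V)) d v

lemma c_i_mul (d : Module.Dual ℝ V) (v : V) (b : A) :
    c d (i v * b) = d v • b - i v * c d b :=
  CliffordAlgebra.contractLeft_ι_mul (Q := (0 : QuadraticForm ℝ V)) d v b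

lemma c_c (d : Module.Dual ℝ V) (b : A) : c d (c d b) = 0 :=
  CliffordAlgebra.contractLeft_contractLeft (Q := (0 : QuadraticForm ℝ V)) d b

lemma c_comm (d e : Module.Dual ℝ V) (b : A) : c d (c e b) = - c e (c d b) :=
  CliffordAlgebra.contractLeft_comm (Q := (0 : QuadraticForm ℝ V)) d e b

lemma ind {P : A → Prop} (h1 : ∀ a b, P (i a * i b))
    (h2 : ∀ x y, P x → P y → P (x + y)) {w : A} (hw : w ∈ ⋀[ℝ]^2 V) : P w := by
  rw [ExteriorAlgebra.exteriorPower, pow_two] at hw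
  refine Submodule.mul_induction_on hw ?_ h2
  rintro _ ⟨a, rfl⟩ _ ⟨b, rfl⟩
  exact h1 a b

lemma c_i_i (d : Module.Dual ℝ V) (a b : V) : c d (i a * i b) = i (d a • b - d b • a) := by
  rw [c_i_mul, c_i, map_sub, map_smul, map_smul, ← Algebra.commutes, ← Algebra.smul_def]

lemma c_mem (d : Module.Dual ℝ V) {w : A} (hw : w ∈ ⋀[ℝ]^2 V) : ∃ v, i v = c d w := by
  refine ind (P := fun w => ∃ v, i v = c d w) ?_ ?_ hw
  · intro a b
    exact ⟨_, (c_i_i d a b).symm⟩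
  · rintro x y ⟨v, hv⟩ ⟨u, hu⟩
    exact ⟨v + u, by rw [map_add, map_add, hv, hu]⟩

lemma c_mul (d : Module.Dual ℝ V) {w : A} (hw : w ∈ ⋀[ℝ]^2 V) (b : A) :
    c d (w * b) = c d w * b + w * c d b := by
  refine ind (P := fun w => c d (w * b) = c d w * b + w * c d b) ?_ ?_ hw
  · intro x y
    rw [mul_assoc, c_i_mul, c_i_mul, c_i_mul, c_i, mul_sub, sub_mul, ← Algebra.commutes,
      ← Algebra.smul_def, mul_smul_comm, smul_mul_assoc, smul_mul_assoc]
    simp only [mul_assoc]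
    abel
  · intro x y hx hy
    rw [add_mul, map_add, map_add, hx, hy]
    simp only [add_mul]
    abel

lemma sum_i (b : V) : ∑ k, b k • i (Pi.single k (1:ℝ)) = (i b : A) := by
  simp only [← map_smul, ← map_sum]
  congr 1
  ext j
  simp [Finset.sum_apply, Pi.single_apply]

lemma anti (a b : V) : (i b * i a : A) = - (i a * i b) := by
  have := ExteriorAlgebra.ι_add_mul_swap (R := ℝ) a b
  exact eq_neg_of_add_eq_zero_right this

lemma euler {w : A} (hw : w ∈ ⋀[ℝ]^2 V) :
    ∑ k, i (Pi.single k (1:ℝ)) * c (LinearMap.proj k) w = (2 : ℝ) • w := by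
  refine ind (P := fun w => ∑ k, i (Pi.single k (1:ℝ)) * c (LinearMap.proj k) w = (2 : ℝ) • w)
    ?_ ?_ hw
  · intro a b
    simp only [c_i_i, map_sub, map_smul, mul_sub, mul_smul_comm, ← smul_mul_assoc,
      Finset.sum_sub_distrib, ← Finset.sum_mul, LinearMap.proj_apply, sum_i]
    rw [anti a b, smul_mul_assoc, two_smul, sub_neg_eq_add]
  · intro x y hx hy
    simp only [map_add, mul_add, Finset.sum_add_distrib, hx, hy, smul_add]

lemma eq_zero {w : A} (hw : w ∈ ⋀[ℝ]^2 V) (h : ∀ d, c d w = 0) : w = 0 := by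
  have := euler hw
  simp only [h, mul_zero, Finset.sum_const_zero] at this
  exact (smul_eq_zero.1 this.symm).resolve_left two_ne_zero

/-- Contraction, valued in vectors. -/
noncomputable def p (d : Module.Dual ℝ V) : A →ₗ[ℝ] V := ExteriorAlgebra.ιInv ∘ₗ c d

lemma i_p (d : Module.Dual ℝ V) {w : A} (hw : w ∈ ⋀[ℝ]^2 V) : i (p d w) = c d w := by
  obtain ⟨v, hv⟩ := c_mem d hw
  rw [p, LinearMap.comp_apply, ← hv]
  exact congrArg _ (ExteriorAlgebra.ι_leftInverse v)

lemma alg_inj {x : ℝ} (h : algebraMap ℝ A x = 0) : x = 0 :=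
  (ExteriorAlgebra.algebraMap_leftInverse V).injective (by rw [h, map_zero])

lemma d_p (d : Module.Dual ℝ V) {w : A} (hw : w ∈ ⋀[ℝ]^2 V) : d (p d w) = 0 := by
  apply alg_inj (n := n)
  rw [← c_i, i_p d hw, c_c]

lemma exists_dual {v : V} (hv : v ≠ 0) : ∃ e : Module.Dual ℝ V, e v = 1 := by
  obtain ⟨k, hk⟩ := Function.ne_iff.1 hv
  refine ⟨(v k)⁻¹ • LinearMap.proj k, ?_⟩
  simpa using inv_mul_cancel₀ hk

lemma parallel {u v : V} (hu : u ≠ 0) (h : (i u * i v : A) = 0) : ∃ t : ℝ, t • u = v := by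
  obtain ⟨e, he⟩ := exists_dual hu
  have h1 := congrArg (c e) h
  rw [c_i_i, map_zero, he, one_smul] at h1
  have := i_inj (h1.trans (map_zero i).symm)
  exact ⟨e v, (sub_eq_zero.1 this).symm⟩

lemma finrank_le_one_of {U : Submodule ℝ V} {v : V}
    (h : ∀ u ∈ U, ∃ t : ℝ, t • v = u) : Module.finrank ℝ U ≤ 1 := by
  have : U ≤ Submodule.span ℝ {v} := fun u hu => Submodule.mem_span_singleton.2 (h u hu)
  exact (Submodule.finrank_mono this).trans
    ((finrank_span_le_card ({v} : Set V)).trans (by simp))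

lemma sum_le {X U I : Submodule ℝ V} (hU : U ≤ X) (hI : I ≤ X)
    (h : ∀ u ∈ U, ∀ v ∈ I, (i u * i v : A) = 0) (hX : 2 ≤ Module.finrank ℝ X) :
    Module.finrank ℝ U + Module.finrank ℝ I ≤ Module.finrank ℝ X := by
  by_cases h1 : U = ⊥
  · subst h1; simpa using Submodule.finrank_mono hI
  by_cases h2 : I = ⊥
  · subst h2; simpa using Submodule.finrank_mono hU
  obtain ⟨u, hu, hu0⟩ := Submodule.exists_mem_ne_zero_of_ne_bot h1
  obtain ⟨v, hv, hv0⟩ := Submodule.exists_mem_ne_zero_of_ne_bot h2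
  have a1 := finrank_le_one_of (U := I) (v := u) fun x hx => parallel hu0 (h u hu x hx)
  have a2 := finrank_le_one_of (U := U) (v := v) fun x hx => parallel hv0
    (by rw [anti, h x hx v hv, neg_zero])
  omega

lemma finrank_ker_two (d e : Module.Dual ℝ V) {v x : V} (h1 : d v = 0) (h2 : e v = 1)
    (h3 : d x ≠ 0) : Module.finrank ℝ (LinearMap.ker (d.prod e) : Submodule ℝ V) + 2 = n := by
  have hs : LinearMap.range (d.prod e) = ⊤ := by
    rw [LinearMap.range_eq_top]
    rintro ⟨a, b⟩
    refine ⟨(a / d x) • x + (b - a / d x * e x) • v, ?_⟩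
    simp [h1, h2, h3]
  have := LinearMap.finrank_range_add_finrank_ker (d.prod e)
  rw [hs, finrank_top] at this
  simp at this
  omega

theorem main (hn : 5 ≤ n) (W : Submodule ℝ A) (hW2 : W ≤ ⋀[ℝ]^2 V)
    (hann : ∀ w₁ ∈ W, ∀ w₂ ∈ W, w₁ * w₂ = 0) : Module.finrank ℝ W ≤ n - 1 := by
  by_cases h0 : ∀ d, ∀ w ∈ W, c d w = 0
  · have : W = ⊥ := (Submodule.eq_bot_iff _).2 fun w hw => eq_zero (hW2 hw) fun d => h0 d w hw
    subst this
    simp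
  push Not at h0
  obtain ⟨d, w0, hw0, hd⟩ := h0
  set v := p d w0 with hv
  have hv0 : v ≠ 0 := fun h => hd (by rw [← i_p d (hW2 hw0), ← hv, h, map_zero])
  have hdv : d v = 0 := d_p d (hW2 hw0)
  obtain ⟨e, he⟩ := exists_dual hv0
  have hdx : ∃ x, d x ≠ 0 := by
    by_contra! hx
    have : d = 0 := LinearMap.ext hx
    subst this
    exact hd (by simp [c])
  obtain ⟨x, hx⟩ := hdx
  have hfd := finrank_ker_two d e hdv he hx
  have : Module.Finite ℝ W := Submodule.finiteDimensional_of_le hW2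
  let f : W →ₗ[ℝ] V := p d ∘ₗ W.subtype
  let K := LinearMap.ker f
  let g : K →ₗ[ℝ] V := p e ∘ₗ W.subtype ∘ₗ K.subtype
  let I := LinearMap.range f
  let I' := (LinearMap.ker (e.domRestrict I)).map I.subtype
  have hK : ∀ w : K, c d (w : A) = 0 := fun w => by
    rw [← i_p d (hW2 w.1.2)]
    have : p d (w : A) = 0 := w.2
    rw [this, map_zero]
  -- elements of the kernel annihilate the image
  have hKI : ∀ w : K, ∀ y ∈ I, (w : A) * i y = 0 := by
    rintro w _ ⟨w', rfl⟩
    have h1 := congrArg (c d) (hann _ w.1.2 _ w'.2)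
    rw [c_mul d (hW2 w.1.2), hK, zero_mul, zero_add, map_zero, ← i_p d (hW2 w'.2)] at h1
    exact h1
  have hvI : v ∈ I := ⟨⟨w0, hw0⟩, rfl⟩
  have hKe : ∀ w : K, (w : A) = - (i (g w) * i v) := fun w => by
    have h1 := congrArg (c e) (hKI w v hvI)
    rw [c_mul e (hW2 w.1.2), c_i, he, map_one, mul_one, map_zero, ← i_p e (hW2 w.1.2)] at h1
    exact eq_neg_of_add_eq_zero_right h1
  have hg : Function.Injective g := by
    rw [injective_iff_map_eq_zero]
    intro w hw
    have := hKe w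
    rw [hw, map_zero, zero_mul, neg_zero] at this
    exact Subtype.ext (Subtype.ext this)
  have hge : ∀ w : K, e (g w) = 0 := fun w => d_p e (hW2 w.1.2)
  have hgd : ∀ w : K, d (g w) = 0 := fun w => by
    apply alg_inj (n := n)
    rw [← c_i]
    have : i (g w) = c e (w : A) := i_p e (hW2 w.1.2)
    rw [this, c_comm, hK, map_zero, neg_zero]
  have hI' : ∀ y ∈ I', y ∈ I ∧ e y = 0 := by
    rintro _ ⟨y, hy, rfl⟩
    exact ⟨y.2, hy⟩
  have hdI : ∀ y ∈ I, d y = 0 := by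
    rintro _ ⟨w, rfl⟩
    exact d_p d (hW2 w.2)
  have key := sum_le (X := LinearMap.ker (d.prod e)) (U := LinearMap.range g) (I := I')
    (by
      rintro _ ⟨w, rfl⟩
      simp [hge, hgd])
    (by
      intro y hy
      simp [hdI y (hI' y hy).1, (hI' y hy).2])
    (by
      rintro _ ⟨w, rfl⟩ y hy
      obtain ⟨hyI, hye⟩ := hI' y hy
      have h1 := hKI w y hyI
      rw [hKe, anti v (g w), neg_neg, mul_assoc] at h1
      have h2 := congrArg (c e) h1
      rw [c_i_mul, c_i_i, he, hge, hye] at h2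
      simpa using h2)
    (by omega)
  have r1 := LinearMap.finrank_range_add_finrank_ker f
  have r2 := LinearMap.finrank_range_of_inj hg
  have r3 := LinearMap.finrank_range_add_finrank_ker (e.domRestrict I)
  have r4 : Module.finrank ℝ (LinearMap.range (e.domRestrict I)) ≤ 1 := by
    simpa using Submodule.finrank_le (LinearMap.range (e.domRestrict I))
  have r5 : Module.finrank ℝ I' = Module.finrank ℝ (LinearMap.ker (e.domRestrict I)) :=
    Submodule.finrank_map_subtype_eq _ _
  have r6 : Module.finrank ℝ I = Module.finrank ℝ (LinearMap.range f) := rfl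
  have r7 : Module.finrank ℝ K = Module.finrank ℝ (LinearMap.ker f) := rfl
  omega

end EKR

/-- **Erdős–Ko–Rado for 2-forms.** If `n ≥ 5` and `W` is a self-annihilating
subspace of `Λ²(ℝⁿ)` (i.e. `w₁ ∧ w₂ = 0` for all `w₁, w₂ ∈ W`), then
`dim W ≤ n - 1`. -/
theorem ekr_two_forms_dim_le (n : ℕ) (hn : 5 ≤ n)
    (W : Submodule ℝ (ExteriorAlgebra ℝ (Fin n → ℝ)))
    (hW2 : W ≤ ⋀[ℝ]^2 (Fin n → ℝ))
    (hann : ∀ w₁ ∈ W, ∀ w₂ ∈ W, w₁ * w₂ = 0) :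
    Module.finrank ℝ W ≤ n - 1 :=
  EKR.main hn W hW2 hann
end

section
/- Let n ≥ 5 and let W be a self-annihilating subspace of Λ²(ℝⁿ). If there is no vector a ∈ ℝⁿ such that every element of W is of the form a ∧ v for some v ∈ ℝⁿ, then dim W ≤ 3. -/
set_option linter.unusedSimpArgs false

namespace HM

open ExteriorAlgebra CliffordAlgebra

variable {n : ℕ}

/-- The inclusion of vectors. -/
local notation "e" => ExteriorAlgebra.ι ℝ (M := Fin n → ℝ)

/-- Contraction with a functional. -/
local notation "ct" => CliffordAlgebra.contractLeft (Q := (0 : QuadraticForm ℝ (Fin n → ℝ)))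

abbrev Du (n : ℕ) := Module.Dual ℝ (Fin n → ℝ)

lemma ct_mul (d : Du n) (a : Fin n → ℝ) (x : ExteriorAlgebra ℝ (Fin n → ℝ)) :
    ct d (e a * x) = d a • x - e a * ct d x :=
  CliffordAlgebra.contractLeft_ι_mul ..

lemma ct_e (d : Du n) (a : Fin n → ℝ) :
    ct d (e a) = algebraMap ℝ _ (d a) :=
  CliffordAlgebra.contractLeft_ι ..

lemma ct_ee (d : Du n) (a b : Fin n → ℝ) :
    ct d (e a * e b) = d a • e b - d b • e a := by
  rw [ct_mul, ct_e, Algebra.smul_def (d b), Algebra.commutes]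

lemma ee_self (a : Fin n → ℝ) : e a * e a = 0 := ExteriorAlgebra.ι_sq_zero a

lemma ee_swap (a b : Fin n → ℝ) : e a * e b = - (e b * e a) := by
  have := ExteriorAlgebra.ι_add_mul_swap (R := ℝ) a b
  exact eq_neg_of_add_eq_zero_left this

lemma e_inj {a b : Fin n → ℝ} (h : e a = e b) : a = b := (ExteriorAlgebra.ι_inj ℝ a b).1 h

lemma ind {P : ExteriorAlgebra ℝ (Fin n → ℝ) → Prop}
    (h1 : ∀ a b, P (e a * e b)) (h2 : ∀ x y, P x → P y → P (x + y))
    {w : ExteriorAlgebra ℝ (Fin n → ℝ)} (hw : w ∈ ⋀[ℝ]^2 (Fin n → ℝ)) : P w := by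
  rw [exteriorPower, pow_two] at hw
  refine Submodule.mul_induction_on hw ?_ h2
  rintro _ ⟨a, rfl⟩ _ ⟨b, rfl⟩
  exact h1 a b

lemma ex_vec {w : ExteriorAlgebra ℝ (Fin n → ℝ)} (hw : w ∈ ⋀[ℝ]^2 (Fin n → ℝ)) :
    ∀ d : Du n, ∃ v, ct d w = e v := by
  intro d
  refine ind (P := fun w => ∃ v, ct d w = e v)
    (fun a b => ?_) (fun x z hx hy => ?_) hw
  · exact ⟨d a • b - d b • a, by rw [ct_ee]; simp⟩
  ·
    obtain ⟨v, hv⟩ := hx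
    obtain ⟨u, hu⟩ := hy
    exact ⟨v + u, by rw [map_add, map_add, hv, hu]⟩

lemma comm {w : ExteriorAlgebra ℝ (Fin n → ℝ)} (hw : w ∈ ⋀[ℝ]^2 (Fin n → ℝ)) (v : Fin n → ℝ) :
    w * e v = e v * w := by
  refine ind (P := fun w => w * e v = e v * w)
    (fun a b => ?_) (fun x z hx hy => ?_) hw
  ·
    rw [mul_assoc, ee_swap b v, mul_neg, ← mul_assoc, ee_swap a v, neg_mul, neg_neg, mul_assoc]
  · rw [add_mul, mul_add, hx, hy]

lemma deriv' {w : ExteriorAlgebra ℝ (Fin n → ℝ)} (hw : w ∈ ⋀[ℝ]^2 (Fin n → ℝ)) (d : Du n)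
    (y : ExteriorAlgebra ℝ (Fin n → ℝ)) :
    ct d (w * y) = ct d w * y + w * ct d y := by
  refine ind (P := fun w => ct d (w * y) = ct d w * y + w * ct d y)
    (fun a b => ?_) (fun x z hx hy => ?_) hw
  ·
    rw [ct_ee, mul_assoc, ct_mul, ct_mul, mul_sub, sub_mul, smul_mul_assoc, smul_mul_assoc,
      mul_smul_comm, mul_assoc]
    abel
  · rw [add_mul, map_add, map_add, hx, hy, add_mul, add_mul]; abel

/-- Vectors in the support of a square-zero 2-form annihilate it. -/
lemma supp {w : ExteriorAlgebra ℝ (Fin n → ℝ)} (hw : w ∈ ⋀[ℝ]^2 (Fin n → ℝ)) (h0 : w * w = 0)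
    (d : Du n) : ct d w * w = 0 := by
  have h := deriv' hw d w
  obtain ⟨v, hv⟩ := ex_vec hw d
  rw [h0, map_zero, hv, comm hw, ← two_smul ℝ] at h
  rw [hv]
  have := (smul_eq_zero.1 h.symm).resolve_left two_ne_zero
  exact this

lemma sum_ct {w : ExteriorAlgebra ℝ (Fin n → ℝ)} (hw : w ∈ ⋀[ℝ]^2 (Fin n → ℝ)) :
    ∑ i, e (Pi.single i 1) * ct (LinearMap.proj i : Du n) w = (2 : ℝ) • w := by
  have key : ∀ a : Fin n → ℝ, ∑ i, a i • e (Pi.single i 1) = e a := by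
    intro a
    conv_rhs => rw [pi_eq_sum_univ' a]
    rw [map_sum]
    refine Finset.sum_congr rfl fun i _ => ?_
    rw [← map_smul]
  refine ind (P := fun w => ∑ i, e (Pi.single i 1) * ct (LinearMap.proj i : Du n) w = (2 : ℝ) • w)
    (fun a b => ?_) (fun x z hx hy => ?_) hw
  ·
    have : ∀ i, e (Pi.single i 1) * ct (LinearMap.proj i : Du n) (e a * e b)
        = (a i • e (Pi.single i 1)) * e b - (b i • e (Pi.single i 1)) * e a := by
      intro i
      rw [ct_ee, mul_sub, mul_smul_comm, mul_smul_comm, smul_mul_assoc, smul_mul_assoc]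
      rfl
    simp_rw [this]
    rw [Finset.sum_sub_distrib, ← Finset.sum_mul, ← Finset.sum_mul, key, key, ee_swap b a,
      two_smul, sub_neg_eq_add]
  · simp only [map_add, mul_add, Finset.sum_add_distrib, hx, hy, smul_add]

lemma ex_one {v : Fin n → ℝ} (hv : v ≠ 0) : ∃ d : Du n, d v = 1 := by
  have : ∃ i, v i ≠ 0 := by
    by_contra! h
    exact hv (funext h)
  obtain ⟨i, hi⟩ := this
  exact ⟨(v i)⁻¹ • LinearMap.proj i, by simp [hi]⟩

/-- Decomposability of square-zero 2-forms, with dual functionals. -/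
lemma decomp {w : ExteriorAlgebra ℝ (Fin n → ℝ)} (hw : w ∈ ⋀[ℝ]^2 (Fin n → ℝ)) (h0 : w * w = 0)
    (hne : w ≠ 0) : ∃ (a b : Fin n → ℝ) (α β : Du n), w = e a * e b ∧
      α a = 1 ∧ α b = 0 ∧ β a = 0 ∧ β b = 1 := by
  have : ∃ d : Du n, ct d w ≠ 0 := by
    by_contra! h
    have h2 := sum_ct hw
    simp only [h, mul_zero, Finset.sum_const_zero] at h2
    exact hne ((smul_eq_zero.1 h2.symm).resolve_left two_ne_zero)
  obtain ⟨d, hd⟩ := this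
  obtain ⟨a, ha⟩ := ex_vec hw d
  have ha0 : a ≠ 0 := by
    rintro rfl
    rw [ha, map_zero] at hd
    exact hd rfl
  obtain ⟨f, hf⟩ := ex_one ha0
  obtain ⟨b, hb⟩ := ex_vec hw f
  have h1 := supp hw h0 d
  rw [ha] at h1
  have h2 := congrArg (ct f) h1
  rw [ct_mul, hf, hb, map_zero, one_smul, sub_eq_zero] at h2
  have alg : ∀ {x y : ℝ}, algebraMap ℝ (ExteriorAlgebra ℝ (Fin n → ℝ)) x = algebraMap ℝ _ y →
      x = y := fun h => (algebraMap ℝ (ExteriorAlgebra ℝ (Fin n → ℝ))).injective h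
  have s1 : ∀ (g : Du n) v, ct g w = e v → g v = 0 := by
    intro g v h
    apply alg
    rw [← ct_e, ← h, map_zero]
    exact CliffordAlgebra.contractLeft_contractLeft ..
  have s2 : d b = - f a := by
    apply alg
    rw [map_neg, ← ct_e, ← ct_e, ← ha, ← hb]
    exact CliffordAlgebra.contractLeft_comm ..
  refine ⟨a, b, f, -d, h2, hf, s1 _ _ hb, ?_, ?_⟩
  · simp [s1 _ _ ha]
  · simp [s2, hf]

lemma formula {w : ExteriorAlgebra ℝ (Fin n → ℝ)} {c b p q : Fin n → ℝ} {γ β : Du n}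
    (h : e c * e b * w = 0) (h1 : γ c = 1) (h2 : γ b = 0) (h3 : β c = 0) (h4 : β b = 1)
    (hp : ct γ w = e p) (hq : ct β w = e q) :
    w = e c * e p + e b * e q - β p • (e c * e b) := by
  have h5 := congrArg (fun x => ct β (ct γ x)) h
  simp only [mul_assoc, ct_mul, map_zero, map_sub, map_smul, map_neg, h1, h2, h3, h4, hp, hq,
    one_smul, zero_smul, zero_sub, mul_neg, sub_neg_eq_add, map_add, ct_e, mul_sub] at h5
  rw [← Algebra.commutes, ← Algebra.smul_def, mul_smul_comm] at h5
  rw [← sub_eq_zero, ← h5]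
  abel

lemma prop {p q : Fin n → ℝ} {ρ : Du n} (h : e p * e q = 0) (h1 : ρ p = 1) : q = ρ q • p := by
  have h2 := congrArg (ct ρ) h
  rw [ct_ee, h1, one_smul, map_zero, sub_eq_zero, ← map_smul] at h2
  exact e_inj h2

lemma anti (w : ExteriorAlgebra ℝ (Fin n → ℝ)) {d f : Du n} {p q : Fin n → ℝ}
    (hp : ct d w = e p) (hq : ct f w = e q) : f p = - d q := by
  apply (algebraMap ℝ (ExteriorAlgebra ℝ (Fin n → ℝ))).injective
  rw [map_neg, ← ct_e, ← ct_e, ← hp, ← hq]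
  exact CliffordAlgebra.contractLeft_comm ..

lemma anti_self (w : ExteriorAlgebra ℝ (Fin n → ℝ)) {d : Du n} {p : Fin n → ℝ}
    (hp : ct d w = e p) : d p = 0 := by
  have := anti w hp hp
  linarith

/-- Two of the three sides of the triangle. -/
lemma step1 (W : Submodule ℝ (ExteriorAlgebra ℝ (Fin n → ℝ)))
    (hW2 : W ≤ ⋀[ℝ]^2 (Fin n → ℝ))
    (hann : ∀ w₁ ∈ W, ∀ w₂ ∈ W, w₁ * w₂ = 0) {w₀ w₁ : ExteriorAlgebra ℝ (Fin n → ℝ)}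
    (h0 : w₀ ∈ W) (h1 : w₁ ∈ W) (hne : w₀ ≠ 0) (hind : ∀ t : ℝ, w₁ ≠ t • w₀) :
    ∃ (c b r : Fin n → ℝ) (γ β ρ : Du n), e c * e b ∈ W ∧ e c * e r ∈ W ∧
      γ c = 1 ∧ γ b = 0 ∧ γ r = 0 ∧ β c = 0 ∧ β b = 1 ∧ β r = 0 ∧
      ρ c = 0 ∧ ρ b = 0 ∧ ρ r = 1 := by
  obtain ⟨a, b, α, β, rfl, aa, ab, ba, bb⟩ := decomp (hW2 h0) (hann _ h0 _ h0) hne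
  obtain ⟨p₁, hp₁⟩ := ex_vec (hW2 h1) α
  obtain ⟨q₁, hq₁⟩ := ex_vec (hW2 h1) β
  have hf₁ := formula (hann _ h0 _ h1) aa ab ba bb hp₁ hq₁
  -- subtract a multiple of `w₀`
  set w := w₁ - (β p₁) • (e a * e b) with hw
  have hwW : w ∈ W := W.sub_mem h1 (W.smul_mem _ h0)
  have hw0 : w ≠ 0 := fun h => hind _ (sub_eq_zero.1 h)
  obtain ⟨p, hp⟩ := ex_vec (hW2 hwW) α
  obtain ⟨q, hq⟩ := ex_vec (hW2 hwW) β
  have hf := formula (hann _ h0 _ hwW) aa ab ba bb hp hq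
  have hβp : β p = 0 := by
    have : p = p₁ - β p₁ • b := by
      apply e_inj
      rw [← hp, hw, map_sub, map_smul, ct_ee, hp₁, aa, ab]
      simp
    rw [this]
    simp [bb]
  have hαp := anti_self w hp
  have hβq := anti_self w hq
  have hαq : α q = 0 := by have := anti w hp hq; linarith
  rw [hβp, zero_smul, sub_zero] at hf
  have ext : ∀ r : Fin n → ℝ, r ≠ 0 → α r = 0 → β r = 0 →
      ∃ ρ : Du n, ρ a = 0 ∧ ρ b = 0 ∧ ρ r = 1 := by
    intro r hr h1 h2
    obtain ⟨ρ, hρ⟩ := ex_one hr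
    exact ⟨ρ - ρ a • α - ρ b • β, by simp [aa, ba], by simp [ab, bb], by simp [h1, h2, hρ]⟩
  by_cases hp0 : p = 0
  · have hq0 : q ≠ 0 := by
      rintro rfl
      rw [hp0] at hf
      simp at hf
      exact hw0 hf
    obtain ⟨ρ, ra, rb, rq⟩ := ext q hq0 hαq hβq
    refine ⟨b, -a, q, β, -α, ρ, ?_, ?_, bb, ?_, hβq, ?_, ?_, ?_, rb, ?_, rq⟩
    · rw [map_neg, mul_neg, ← ee_swap]
      exact h0
    · rw [hp0] at hf
      simp only [map_zero, mul_zero, zero_add] at hf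
      rw [← hf]
      exact hwW
    all_goals simp [*]
  · obtain ⟨ρ, ra, rb, rp⟩ := ext p hp0 hαp hβp
    have hs := supp (hW2 hwW) (hann _ hwW _ hwW) α
    rw [hp, hf, mul_add, ← mul_assoc, ee_swap p a, neg_mul, mul_assoc, ee_self, mul_zero, neg_zero,
      zero_add, ← mul_assoc, ee_swap p b, neg_mul, neg_eq_zero, mul_assoc] at hs
    have hs2 := congrArg (ct β) hs
    rw [ct_mul, bb, one_smul, ct_ee, hβp, hβq] at hs2
    simp only [zero_smul, sub_zero, mul_zero, map_zero] at hs2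
    have hq' := prop hs2 rp
    set τ := ρ q
    refine ⟨a + τ • b, b, p, α, β - τ • α, ρ, ?_, ?_, ?_, ab, hαp, ?_, ?_, ?_, ?_, rb, rp⟩
    · rw [map_add, map_smul, add_mul, smul_mul_assoc, ee_self, smul_zero, add_zero]
      exact h0
    · rw [map_add, map_smul, add_mul, smul_mul_assoc, ← mul_smul_comm, ← map_smul, ← hq', ← hf]
      exact hwW
    all_goals simp [aa, ab, ba, bb, hαp, hβp, ra, rb]

/-- Adjusting a form in `W` by the first two sides. -/
lemma step2 (W : Submodule ℝ (ExteriorAlgebra ℝ (Fin n → ℝ)))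
    (hW2 : W ≤ ⋀[ℝ]^2 (Fin n → ℝ))
    (hann : ∀ w₁ ∈ W, ∀ w₂ ∈ W, w₁ * w₂ = 0) {c b r : Fin n → ℝ} {γ β ρ : Du n}
    (hcb : e c * e b ∈ W) (hcr : e c * e r ∈ W)
    (gc : γ c = 1) (gb : γ b = 0) (gr : γ r = 0) (bc : β c = 0) (bb : β b = 1) (br : β r = 0)
    (rc : ρ c = 0) (rb : ρ b = 0) (rr : ρ r = 1)
    {w₁ : ExteriorAlgebra ℝ (Fin n → ℝ)} (h1 : w₁ ∈ W) :
    ∃ (s t u : ℝ) (p : Fin n → ℝ), γ p = 0 ∧ β p = 0 ∧ ρ p = 0 ∧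
      w₁ - s • (e c * e b) - t • (e c * e r) = e c * e p + u • (e b * e r) := by
  obtain ⟨p₁, hp₁⟩ := ex_vec (hW2 h1) γ
  refine ⟨β p₁, ρ p₁, ?_⟩
  set w := w₁ - (β p₁) • (e c * e b) - (ρ p₁) • (e c * e r) with hw
  have hwW : w ∈ W := W.sub_mem (W.sub_mem h1 (W.smul_mem _ hcb)) (W.smul_mem _ hcr)
  obtain ⟨p, hp⟩ := ex_vec (hW2 hwW) γ
  obtain ⟨q, hq⟩ := ex_vec (hW2 hwW) β
  obtain ⟨x, hx⟩ := ex_vec (hW2 hwW) ρ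
  have hpe : p = p₁ - β p₁ • b - ρ p₁ • r := by
    apply e_inj
    rw [← hp, hw, map_sub, map_sub, map_smul, map_smul, ct_ee, ct_ee, hp₁, gc, gb, gr]
    simp
  have hβp : β p = 0 := by rw [hpe]; simp [bb, br]
  have hρp : ρ p = 0 := by rw [hpe]; simp [rb, rr]
  have hf1 := formula (hann _ hcb _ hwW) gc gb bc bb hp hq
  have hf2 := formula (hann _ hcr _ hwW) gc gr rc rr hp hx
  rw [hβp, zero_smul, sub_zero] at hf1
  rw [hρp, zero_smul, sub_zero] at hf2
  have hqx : e b * e q = e r * e x := by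
    have := hf1.symm.trans hf2
    exact add_left_cancel this
  have h3 := congrArg (ct β) hqx
  rw [ct_ee, ct_ee, bb, br, anti_self w hq] at h3
  simp only [one_smul, zero_smul, sub_zero, zero_sub] at h3
  refine ⟨-β x, p, anti_self w hp, hβp, hρp, ?_⟩
  rw [hf1, h3, mul_neg, mul_smul_comm, neg_smul]

end HM


/-- **Hilton–Milner for 2-forms (inequality).** If `n ≥ 5` and `W` is a
self-annihilating subspace of `Λ²(ℝⁿ)` such that there is no vector `a ∈ ℝⁿ`
with every element of `W` of the form `a ∧ v`, then `dim W ≤ 3`. -/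
theorem hilton_milner_two_forms_dim_le (n : ℕ) (hn : 5 ≤ n)
    (W : Submodule ℝ (ExteriorAlgebra ℝ (Fin n → ℝ)))
    (hW2 : W ≤ ⋀[ℝ]^2 (Fin n → ℝ))
    (hann : ∀ w₁ ∈ W, ∀ w₂ ∈ W, w₁ * w₂ = 0)
    (hnota : ¬ ∃ a : Fin n → ℝ, ∀ w ∈ W, ∃ v : Fin n → ℝ,
      w = ExteriorAlgebra.ι ℝ a * ExteriorAlgebra.ι ℝ v) :
    Module.finrank ℝ W ≤ 3 := by
  classical
  by_contra hcon
  push Not at hcon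
  -- `W` is not contained in the span of few elements
  have notspan : ∀ x y z : ExteriorAlgebra ℝ (Fin n → ℝ),
      ¬ W ≤ Submodule.span ℝ (({x, y, z} : Finset _) : Set (ExteriorAlgebra ℝ (Fin n → ℝ))) := by
    intro x y z h
    have h1 := Submodule.finrank_mono h
    have h2 := finrank_span_finset_le_card (R := ℝ) ({x, y, z} : Finset _)
    have h3 := Finset.card_le_three (a := x) (b := y) (c := z)
    simp only [Set.finrank] at h2
    omega
  obtain ⟨w₀, h0, hne⟩ : ∃ w ∈ W, w ≠ 0 := by
    by_contra! h
    exact hnota ⟨0, fun w hw => ⟨0, by simp [h w hw]⟩⟩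
  obtain ⟨w₁, h1, hind⟩ : ∃ w ∈ W, ∀ t : ℝ, w ≠ t • w₀ := by
    by_contra! h
    refine notspan w₀ w₀ w₀ fun w hw => ?_
    obtain ⟨t, rfl⟩ := h w hw
    exact Submodule.smul_mem _ _ (Submodule.subset_span (by simp))
  obtain ⟨c, b, r, γ, β, ρ, hcb, hcr, gc, gb, gr, bc, bb, br, rc, rb, rr⟩ :=
    HM.step1 W hW2 hann h0 h1 hne hind
  have S := fun {w} (hw : w ∈ W) =>
    HM.step2 W hW2 hann hcb hcr gc gb gr bc bb br rc rb rr hw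
  -- the third side lies in `W`
  have hbr : ExteriorAlgebra.ι ℝ b * ExteriorAlgebra.ι ℝ r ∈ W := by
    by_contra hbr
    refine hnota ⟨c, fun w hw => ?_⟩
    obtain ⟨s, t, u, p, gp, bp, rp, hE⟩ := S hw
    have hwW := W.sub_mem (W.sub_mem hw (W.smul_mem s hcb)) (W.smul_mem t hcr)
    rw [hE] at hwW
    by_cases hu : u = 0
    · refine ⟨s • b + t • r + p, ?_⟩
      rw [hu, zero_smul, add_zero, sub_sub, sub_eq_iff_eq_add] at hE
      rw [hE]
      simp only [map_add, map_smul, mul_add, mul_smul_comm]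
      abel
    · exfalso
      have hs := HM.supp (hW2 hwW) (hann _ hwW _ hwW) γ
      rw [map_add, map_smul, HM.ct_ee, HM.ct_ee, gc, gp, gb, gr] at hs
      simp only [one_smul, zero_smul, sub_zero, smul_zero, add_zero] at hs
      rw [mul_add, ← mul_assoc, HM.ee_swap p c, neg_mul, mul_assoc, HM.ee_self, mul_zero, neg_zero,
        zero_add, mul_smul_comm] at hs
      have hs1 := (smul_eq_zero.1 hs).resolve_left hu
      have hs2 := congrArg (fun x => CliffordAlgebra.contractLeft (Q := 0) ρ
        (CliffordAlgebra.contractLeft (Q := 0) β x)) hs1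
      simp only [HM.ct_mul, HM.ct_ee, HM.ct_e, bp, bb, br, rp, rb, rr, zero_smul, one_smul,
        sub_zero, zero_sub, map_zero, map_neg, mul_one, map_one, neg_neg, mul_zero] at hs2
      rw [hs2] at hwW
      simp only [mul_zero, zero_add] at hwW
      exact hbr ((W.smul_mem_iff hu).1 hwW)
  refine notspan (ExteriorAlgebra.ι ℝ c * ExteriorAlgebra.ι ℝ b)
    (ExteriorAlgebra.ι ℝ c * ExteriorAlgebra.ι ℝ r)
    (ExteriorAlgebra.ι ℝ b * ExteriorAlgebra.ι ℝ r) fun w hw => ?_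
  obtain ⟨s, t, u, p, gp, bp, rp, hE⟩ := S hw
  have hwW := W.sub_mem (W.sub_mem hw (W.smul_mem s hcb)) (W.smul_mem t hcr)
  have hz := hann _ hbr _ hwW
  rw [hE, mul_add, mul_smul_comm, hann _ hbr _ hbr, smul_zero, add_zero, mul_assoc] at hz
  have hs2 := congrArg (fun x => CliffordAlgebra.contractLeft (Q := 0) γ
    (CliffordAlgebra.contractLeft (Q := 0) ρ (CliffordAlgebra.contractLeft (Q := 0) β x))) hz
  simp only [HM.ct_mul, HM.ct_ee, HM.ct_e, bp, bb, br, bc, rp, rb, rr, rc, gb, gr, gc, gp,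
    zero_smul, one_smul, sub_zero, zero_sub, map_zero, map_neg, mul_one, map_one, neg_neg,
    mul_zero, neg_zero, smul_zero] at hs2
  rw [hs2, mul_zero, zero_add, sub_sub, sub_eq_iff_eq_add] at hE
  rw [hE]
  refine Submodule.add_mem _ ?_ (Submodule.add_mem _ ?_ ?_) <;>
    exact Submodule.smul_mem _ _ (Submodule.subset_span (by simp))
end
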